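/- For every positive integer n, \(\sum_{k=0}^{n} \binom{2n}{n+k} P_{k}^{2} = 8^{n-1}\). -/

import Mathlib

/-- The Pell numbers: `P 0 = 0`, `P 1 = 1`, `P (n+2) = 2 P (n+1) + P n`. -/
def pellNum : ℕ → ℕ
  | 0 => 0
  | 1 => 1
  | n + 2 => 2 * pellNum (n + 1) + pellNum n

/-- The central binomial expansion of `(2 + a + a⁻¹) ^ n`, folded around its middle term. -/
theorem sum_choose_mul_pow_add_pow {R : Type*} [CommRing R] {a b : R} (hab : a * b = 1) (n : ℕ) :
    ∑ k ∈ Finset.range (n + 1), ((2 * n).choose (n + k) : R) * (a ^ k + b ^ k) =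
      (2 + a + b) ^ n + (2 * n).choose n := by
  have hpow (m : ℕ) : a ^ m * b ^ m = 1 := by rw [← mul_pow, hab, one_pow]
  have hexp : (2 + a + b) ^ n =
      ∑ j ∈ Finset.range (n + (n + 1)), ((2 * n).choose j : R) * (a ^ j * b ^ n) := by
    have hbase : 2 + a + b = (a + 1) ^ 2 * b := by linear_combination (-(a + 2)) * hab
    rw [hbase, mul_pow, ← pow_mul, add_pow, Finset.sum_mul,
      show n + (n + 1) = 2 * n + 1 by ring]
    refine Finset.sum_congr rfl fun j _ => ?_
    ring
  have hupper : ∑ k ∈ Finset.range (n + 1), ((2 * n).choose (n + k) : R) * (a ^ (n + k) * b ^ n) =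
      ∑ k ∈ Finset.range (n + 1), ((2 * n).choose (n + k) : R) * a ^ k := by
    refine Finset.sum_congr rfl fun k _ => ?_
    rw [pow_add]
    linear_combination ((2 * n).choose (n + k) : R) * a ^ k * hpow n
  have hlower : ∑ j ∈ Finset.range (n + 1), ((2 * n).choose j : R) * (a ^ j * b ^ n) =
      ∑ k ∈ Finset.range (n + 1), ((2 * n).choose (n + k) : R) * b ^ k := by
    rw [← Finset.sum_range_reflect]
    refine Finset.sum_congr rfl fun k hk => ?_
    obtain ⟨m, rfl⟩ := Nat.exists_eq_add_of_le (Finset.mem_range_succ_iff.mp hk)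
    rw [show k + m + 1 - 1 - k = m by omega,
      Nat.choose_symm_of_eq_add (show 2 * (k + m) = m + (k + m + k) by ring), pow_add b]
    linear_combination ((2 * (k + m)).choose (k + m + k) : R) * b ^ k * hpow m
  rw [Finset.sum_range_succ, hpow, mul_one] at hlower
  rw [Finset.sum_range_add, hupper] at hexp
  simp only [mul_add, Finset.sum_add_distrib]
  linear_combination -hexp - hlower

/-- Binet's formula for the Pell numbers. -/
theorem pellNum_binet (k : ℕ) :
    2 * √2 * (pellNum k : ℝ) = (1 + √2) ^ k - (1 - √2) ^ k := by
  have hsq : √2 ^ 2 = (2 : ℝ) := Real.sq_sqrt zero_le_two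
  induction k using Nat.twoStepInduction with
  | zero => simp [pellNum]
  | one => simp [pellNum]; ring
  | more k ih₀ ih₁ =>
    rw [pellNum]
    push_cast
    linear_combination 2 * ih₁ + ih₀ - ((1 + √2) ^ k - (1 - √2) ^ k) * hsq

theorem eight_mul_pellNum_sq (k : ℕ) :
    8 * (pellNum k : ℝ) ^ 2 =
      (3 + 2 * √2) ^ k + (3 - 2 * √2) ^ k - ((-1) ^ k + (-1) ^ k) := by
  have hsq : √2 ^ 2 = (2 : ℝ) := Real.sq_sqrt zero_le_two
  rw [show 3 + 2 * √2 = (1 + √2) ^ 2 by linear_combination -hsq,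
    show 3 - 2 * √2 = (1 - √2) ^ 2 by linear_combination -hsq,
    show (-1 : ℝ) = (1 + √2) * (1 - √2) by linear_combination hsq, mul_pow, ← pow_mul, ← pow_mul]
  linear_combination (2 * √2 * (pellNum k : ℝ) + ((1 + √2) ^ k - (1 - √2) ^ k)) * pellNum_binet k
    - 4 * (pellNum k : ℝ) ^ 2 * hsq

/-- For every positive integer `n`, `∑_{k=0}^n C(2n, n+k) P_k² = 8^{n-1}`. -/
theorem sum_choose_pell_sq (n : ℕ) (hn : 0 < n) :
    ∑ k ∈ Finset.range (n + 1), Nat.choose (2 * n) (n + k) * pellNum k ^ 2 =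
      8 ^ (n - 1) := by
  have hsq : √2 ^ 2 = (2 : ℝ) := Real.sq_sqrt zero_le_two
  have hpell := sum_choose_mul_pow_add_pow
    (show (3 + 2 * √2) * (3 - 2 * √2) = 1 by linear_combination -4 * hsq) n
  have halt := sum_choose_mul_pow_add_pow (show (-1 : ℝ) * -1 = 1 by norm_num) n
  rw [show 2 + (3 + 2 * √2) + (3 - 2 * √2) = 8 by ring] at hpell
  rw [show (2 : ℝ) + -1 + -1 = 0 by norm_num, zero_pow hn.ne'] at halt
  have hdiff : 8 * ∑ k ∈ Finset.range (n + 1), ((2 * n).choose (n + k) : ℝ) * (pellNum k : ℝ) ^ 2 =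
      8 ^ n := by
    simp only [Finset.mul_sum, mul_left_comm (8 : ℝ), eight_mul_pellNum_sq, mul_sub,
      Finset.sum_sub_distrib]
    linear_combination hpell - halt
  obtain ⟨m, rfl⟩ := Nat.exists_eq_succ_of_ne_zero hn.ne'
  rw [Nat.succ_eq_add_one, pow_succ'] at hdiff
  exact_mod_cast mul_left_cancel₀ (by norm_num) hdiff
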